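/- Let G be a bridgeless cubic graph with a 2-factor consisting of two odd circuits C1 and C2, let u1u2 be an edge of G with u1 ∈ V(C1) and u2 ∈ V(C2), and let M2 be the perfect matching of G with M2 ∩ (E(G) \ (E(C1) ∪ E(C2))) = {u1u2}. If the circuit containing u1 and the circuit containing u2 in the subgraph of G induced by the edge set E(G) \ M2 coincide, then G is 3-edge-colorable, i.e., G has three pairwise edge-disjoint perfect matchings. -/

import Mathlib

/-- A multigraph on vertex type `V` with edge type `E`: each edge is assigned an
unordered pair of distinct endpoints (multiple edges allowed, loops forbidden). -/
structure Multigraph (V : Type*) (E : Type*) where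
  inc : E → Sym2 V
  no_loops : ∀ e : E, ¬ (inc e).IsDiag

namespace Multigraph

variable {V E : Type*} (G : Multigraph V E)

/-- The set of vertices incident with some edge in the edge set `F`. -/
def supp (F : Set E) : Set V := {v | ∃ e ∈ F, v ∈ G.inc e}

/-- The degree of a vertex `v` in the subgraph given by the edge set `F`. -/
noncomputable def deg (F : Set E) (v : V) : ℕ := {e ∈ F | v ∈ G.inc e}.ncard

/-- `G` is cubic, i.e. 3-regular. -/
def IsCubic : Prop := ∀ v : V, G.deg Set.univ v = 3

/-- Adjacency via an edge of the edge set `F`. -/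
def Adj (F : Set E) (u v : V) : Prop := ∃ e ∈ F, G.inc e = s(u, v)

/-- `u` and `v` are joined by a walk using only edges of `F`. -/
def Reach (F : Set E) : V → V → Prop := Relation.ReflTransGen (G.Adj F)

/-- `G` is bridgeless: no edge is a cut edge, i.e. the ends of every edge are
joined by a walk avoiding that edge. -/
def Bridgeless : Prop :=
  ∀ e : E, ∀ u v : V, G.inc e = s(u, v) → G.Reach (Set.univ \ {e}) u v

/-- `M` is a perfect matching of the subgraph of `G` with vertex set `S` whose
edges are the edges of `F` having both ends in `S`: the edges of `M` lie in `F`,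
have both ends in `S`, and every vertex of `S` lies on exactly one edge of `M`. -/
def IsPMOn (S : Set V) (F : Set E) (M : Set E) : Prop :=
  M ⊆ F ∧ (∀ e ∈ M, ∀ v ∈ G.inc e, v ∈ S) ∧ ∀ v ∈ S, ∃! e, e ∈ M ∧ v ∈ G.inc e

/-- `M` is a perfect matching of `G`. -/
def IsPM (M : Set E) : Prop := G.IsPMOn Set.univ Set.univ M

/-- The edge set `C` is a circuit of `G`: nonempty, 2-regular, and connected. -/
def IsCircuit (C : Set E) : Prop :=
  C.Nonempty ∧ (∀ v ∈ G.supp C, G.deg C v = 2) ∧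
    ∀ u ∈ G.supp C, ∀ v ∈ G.supp C, G.Reach C u v

end Multigraph

namespace Multigraph

variable {V E : Type*} {G : Multigraph V E}

theorem isPM_iff_deg_eq_one {M : Set E} : G.IsPM M ↔ ∀ v, G.deg M v = 1 := by
  simp only [IsPM, IsPMOn, deg, Set.subset_univ, Set.mem_univ, implies_true, true_and,
    forall_const, Set.ncard_eq_one, ExistsUnique, Set.ext_iff, Set.mem_ofPred_eq,
    Set.mem_singleton_iff]
  refine forall_congr' fun v => exists_congr fun e => ⟨fun h f => ⟨h.2 f, ?_⟩, fun h => ?_⟩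
  · rintro rfl
    exact h.1
  · exact ⟨(h e).2 rfl, fun f hf => (h f).1 hf⟩

section Finite

variable [Finite E]

theorem deg_inter_add_deg_diff (A B : Set E) (v : V) :
    G.deg (A ∩ B) v + G.deg (A \ B) v = G.deg A v := by
  have h := Set.ncard_inter_add_ncard_sdiff_eq_ncard {e ∈ A | v ∈ G.inc e} B (Set.toFinite _)
  unfold deg
  rw [← h]
  congr 2 <;> ext e <;> simp only [Set.mem_inter_iff, Set.mem_sdiff, Set.mem_ofPred_eq] <;> tauto

theorem deg_add_deg_compl (A : Set E) (v : V) :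
    G.deg A v + G.deg Aᶜ v = G.deg Set.univ v := by
  simpa [Set.compl_eq_univ_sdiff] using G.deg_inter_add_deg_diff Set.univ A v

theorem deg_mono {A B : Set E} (h : A ⊆ B) (v : V) : G.deg A v ≤ G.deg B v :=
  Set.ncard_le_ncard (fun _ he => ⟨h he.1, he.2⟩) (Set.toFinite _)

theorem deg_union_of_disjoint {A B : Set E} (h : Disjoint A B) (v : V) :
    G.deg (A ∪ B) v = G.deg A v + G.deg B v := by
  rw [← G.deg_inter_add_deg_diff (A ∪ B) A v, Set.union_inter_cancel_left,
    Set.union_sdiff_cancel_left (Set.disjoint_iff.1 h)]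

theorem cast_deg_symmDiff (A B : Set E) (v : V) :
    (G.deg (symmDiff A B) v : ZMod 2) = G.deg A v + G.deg B v := by
  have hu : G.deg (symmDiff A B) v = G.deg (A \ B) v + G.deg (B \ A) v :=
    deg_union_of_disjoint disjoint_sdiff_sdiff v
  rw [hu, ← G.deg_inter_add_deg_diff A B v, ← G.deg_inter_add_deg_diff B A v, Set.inter_comm B A]
  push_cast
  linear_combination -CharTwo.add_self_eq_zero (G.deg (A ∩ B) v : ZMod 2)

end Finite

theorem deg_eq_zero_of_notMem_supp {A : Set E} {v : V} (h : v ∉ G.supp A) : G.deg A v = 0 := by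
  have : {e ∈ A | v ∈ G.inc e} = ∅ := Set.eq_empty_of_forall_notMem fun e he => h ⟨e, he⟩
  simp [deg, this]

theorem disjoint_of_supp_inter_eq_empty {A B : Set E} (h : G.supp A ∩ G.supp B = ∅) :
    Disjoint A B := by
  rw [Set.disjoint_left]
  intro e heA heB
  have hv := Sym2.out_fst_mem (G.inc e)
  exact h.subset ⟨⟨e, heA, hv⟩, ⟨e, heB, hv⟩⟩

open Classical in
theorem deg_singleton (e : E) (v : V) : G.deg {e} v = if v ∈ G.inc e then 1 else 0 := by
  unfold deg
  split_ifs with h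
  · rw [Set.ncard_eq_one]
    exact ⟨e, by ext f; simp +contextual [h]⟩
  · rw [Set.ncard_eq_zero (Set.Finite.subset (Set.finite_singleton e) fun _ hf => hf.1)]
    ext f
    simp +contextual [h]

open Classical in
theorem cast_deg_singleton {e : E} {a b : V} (h : G.inc e = s(a, b)) (v : V) :
    (G.deg {e} v : ZMod 2) = (if v = a then 1 else 0) + (if v = b then 1 else 0) := by
  have hab : a ≠ b := fun hab => G.no_loops e (by simp [h, hab])
  simp only [deg_singleton, h, Sym2.mem_iff]
  by_cases ha : v = a
  · simp [ha, hab]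
  · simp [ha]

open Classical in
/-- Two vertices joined by a walk in `F` are the odd-degree vertices of some subset of `F`. -/
theorem Reach.exists_join [Finite E] {F : Set E} {a b : V} (h : G.Reach F a b) :
    ∃ J ⊆ F, ∀ v, (G.deg J v : ZMod 2) =
      (if v = a then 1 else 0) + (if v = b then 1 else 0) := by
  induction h with
  | refl =>
    refine ⟨∅, Set.empty_subset _, fun v => ?_⟩
    rw [CharTwo.add_self_eq_zero]
    simp [deg]
  | @tail b c _ hbc ih =>
    obtain ⟨J, hJ, hdeg⟩ := ih
    obtain ⟨e, he, hinc⟩ := hbc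
    refine ⟨symmDiff J {e}, ?_, fun v => ?_⟩
    · exact symmDiff_le_sup.trans (Set.union_subset hJ (Set.singleton_subset_iff.2 he))
    · rw [cast_deg_symmDiff, hdeg, cast_deg_singleton hinc]
      linear_combination CharTwo.add_self_eq_zero (if v = b then (1 : ZMod 2) else 0)

end Multigraph

open Multigraph in
/-- From the proof of Theorem 2: if the two circuits coincide, `G` is
3-edge-colorable. -/
theorem statement_8 {V E : Type*} [Fintype V] [Fintype E] (G : Multigraph V E)
    (hcubic : G.IsCubic) (hbridgeless : G.Bridgeless)
    (C1 C2 : Set E) (hC1 : G.IsCircuit C1) (hC2 : G.IsCircuit C2)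
    (hodd1 : Odd C1.ncard) (hodd2 : Odd C2.ncard)
    (hdisj : G.supp C1 ∩ G.supp C2 = ∅)
    (hspan : G.supp C1 ∪ G.supp C2 = Set.univ)
    (u1 u2 : V) (e12 : E) (hinc : G.inc e12 = s(u1, u2))
    (hu1 : u1 ∈ G.supp C1) (hu2 : u2 ∈ G.supp C2)
    (M2 : Set E) (hM2 : G.IsPM M2)
    (hM2cap : M2 ∩ (Set.univ \ (C1 ∪ C2)) = {e12})
    (C3 C4 : Set E)
    (hC3 : G.IsCircuit C3) (hC3sub : C3 ⊆ Set.univ \ M2) (hu1C3 : u1 ∈ G.supp C3)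
    (hC4 : G.IsCircuit C4) (hC4sub : C4 ⊆ Set.univ \ M2) (hu2C4 : u2 ∈ G.supp C4)
    (heq : C3 = C4) :
    ∃ N1 N2 N3 : Set E, G.IsPM N1 ∧ G.IsPM N2 ∧ G.IsPM N3 ∧
      N1 ∩ N2 = ∅ ∧ N1 ∩ N3 = ∅ ∧ N2 ∩ N3 = ∅ := by
  classical
  subst heq
  have hdeg12 : ∀ v, G.deg (C1 ∪ C2) v = 2 := by
    intro v
    rw [deg_union_of_disjoint (disjoint_of_supp_inter_eq_empty hdisj)]
    have hv : v ∈ G.supp C1 ∪ G.supp C2 := hspan ▸ Set.mem_univ v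
    have hnot : ¬ (v ∈ G.supp C1 ∧ v ∈ G.supp C2) := fun h => Set.notMem_empty v (hdisj ▸ h)
    rcases hv with h | h
    · rw [hC1.2.1 v h, deg_eq_zero_of_notMem_supp fun h' => hnot ⟨h, h'⟩]
    · rw [hC2.2.1 v h, deg_eq_zero_of_notMem_supp fun h' => hnot ⟨h', h⟩]
  have hM1 : ∀ v, G.deg (C1 ∪ C2)ᶜ v = 1 := by
    intro v
    have h := G.deg_add_deg_compl (C1 ∪ C2) v
    rw [hdeg12, hcubic v] at h
    omega
  have hM2deg := isPM_iff_deg_eq_one.1 hM2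
  have hM2c : ∀ v, G.deg M2ᶜ v = 2 := by
    intro v
    have h := G.deg_add_deg_compl M2 v
    rw [hM2deg, hcubic v] at h
    omega
  obtain ⟨J, hJ, hJdeg⟩ := (hC3.2.2 u1 hu1C3 u2 hu2C4).exists_join
  set N := symmDiff ((C1 ∪ C2)ᶜ \ M2) J with hN
  have hNsub : N ⊆ M2ᶜ :=
    symmDiff_le_sup.trans (Set.union_subset (fun _ he => he.2) fun _ he => (hC3sub (hJ he)).2)
  have hNdeg : ∀ v, G.deg N v = 1 := by
    intro v
    have hodd : (G.deg N v : ZMod 2) = 1 := by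
      have h := congrArg (Nat.cast : ℕ → ZMod 2) (G.deg_inter_add_deg_diff (C1 ∪ C2)ᶜ M2 v)
      rw [Set.inter_comm, Set.compl_eq_univ_sdiff, hM2cap, ← Set.compl_eq_univ_sdiff, hM1] at h
      push_cast at h
      rw [hN, cast_deg_symmDiff, hJdeg, ← cast_deg_singleton hinc, add_comm, h]
    have hle := (deg_mono hNsub v).trans_eq (hM2c v)
    have := (ZMod.natCast_eq_one_iff_odd).1 hodd
    grind
  have hRdeg : ∀ v, G.deg (M2ᶜ \ N) v = 1 := by
    intro v
    have h := G.deg_inter_add_deg_diff M2ᶜ N v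
    rw [Set.inter_eq_self_of_subset_right hNsub, hNdeg, hM2c] at h
    omega
  refine ⟨M2, N, M2ᶜ \ N, hM2, isPM_iff_deg_eq_one.2 hNdeg, isPM_iff_deg_eq_one.2 hRdeg,
    ?_, ?_, Set.inter_sdiff_self _ _⟩
  · exact Set.disjoint_iff_inter_eq_empty.1 (Set.disjoint_left.2 fun _ h h' => hNsub h' h)
  · exact Set.disjoint_iff_inter_eq_empty.1 (Set.disjoint_left.2 fun _ h h' => h'.1 h)
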